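/- Suppose the Craig conditions (C2) hold. Then Ξ is a Lipschitz vector field on D(S): there is a finite constant K such that for all φ, φ̃ ∈ D(S), sup_{j∈J} γ_j^{1/2} |Ξ_j(φ) − Ξ_j(φ̃)| ≤ K · sup_{j∈J} γ_j^{1/2} d_𝕋(φ_j, φ̃_j). -/

import Mathlib

open scoped Real BigOperators
open Real

noncomputable section

/-- Distance between the gaps indexed by `j` and `l`
(equals `dist ([Em j, Ep j], [Em l, Ep l])` when these closed intervals are disjoint). -/
def gapDist {J : Type*} (Em Ep : J → ℝ) (j l : J) : ℝ :=
  max (Em l - Ep j) (Em j - Ep l)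

/-- Length `γ_j = E_j^+ - E_j^-` of the `j`-th gap. -/
def gapLen {J : Type*} (Em Ep : J → ℝ) (j : J) : ℝ := Ep j - Em j

/-- Craig's constant `C_j = (η_{j,0} + γ_j)^{1/2} ∏_{l ≠ j} (1 + γ_l/η_{j,l})^{1/2}`. -/
def CraigC {J : Type*} (Em Ep : J → ℝ) (E0 : ℝ) (j : J) : ℝ :=
  Real.sqrt ((Em j - E0) + gapLen Em Ep j) *
    ∏' l : {l : J // l ≠ j}, Real.sqrt (1 + gapLen Em Ep l / gapDist Em Ep j l)

/-- `μ_j(φ) = E_j^- + γ_j cos²(φ_j/2) = E_j^- + γ_j (1 + cos φ_j)/2`. -/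
def muD {J : Type*} (Em Ep : J → ℝ) (φ : J → Real.Angle) (j : J) : ℝ :=
  Em j + gapLen Em Ep j * ((1 + Real.Angle.cos (φ j)) / 2)

/-- `Q_1(φ) = E̲ + ∑_j (E_j^- + E_j^+ - 2 μ_j)`. -/
def Q1D {J : Type*} (Em Ep : J → ℝ) (E0 : ℝ) (φ : J → Real.Angle) : ℝ :=
  E0 + ∑' j : J, (Em j + Ep j - 2 * muD Em Ep φ j)

/-- `Ψ_j(φ) = 2 ((μ_j - E̲) ∏_{l≠j} (E_l^- - μ_j)(E_l^+ - μ_j)/(μ_l - μ_j)²)^{1/2}`. -/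
def PsiD {J : Type*} (Em Ep : J → ℝ) (E0 : ℝ) (φ : J → Real.Angle) (j : J) : ℝ :=
  2 * Real.sqrt ((muD Em Ep φ j - E0) *
    ∏' l : {l : J // l ≠ j},
      ((Em l - muD Em Ep φ j) * (Ep l - muD Em Ep φ j) /
        (muD Em Ep φ l - muD Em Ep φ j) ^ 2))

/-- `Ξ_j(φ) = -2 (Q_1(φ) + 2 μ_j) Ψ_j(φ)`. -/
def XiD {J : Type*} (Em Ep : J → ℝ) (E0 : ℝ) (φ : J → Real.Angle) (j : J) : ℝ :=
  -2 * (Q1D Em Ep E0 φ + 2 * muD Em Ep φ j) * PsiD Em Ep E0 φ j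


lemma aux_exp_lip {x y C : ℝ} (hx : Real.exp x ≤ C) (hy : Real.exp y ≤ C) :
    |Real.exp x - Real.exp y| ≤ C * |x - y| := by
  have key : ∀ x y : ℝ, Real.exp x - Real.exp y ≤ Real.exp x * |x - y| := by
    intro x y
    have h1 := Real.add_one_le_exp (y - x)
    have h2 : Real.exp y = Real.exp x * Real.exp (y - x) := by
      rw [← Real.exp_add]; ring_nf
    have h3 := Real.exp_pos x
    have h4 := le_abs_self (x - y)
    rw [h2]
    nlinarith
  have a1 := key x y
  have a2 := key y x
  rw [abs_sub_comm y x] at a2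
  have h0 := abs_nonneg (x - y)
  rw [abs_le]
  constructor <;> nlinarith

lemma aux_log_ratio {p q : ℝ} (hp : 0 < p) (hq : 0 < q) :
    Real.log p - Real.log q ≤ (p - q) / q := by
  rw [← Real.log_div hp.ne' hq.ne']
  have := Real.log_le_sub_one_of_pos (div_pos hp hq)
  calc _ ≤ _ := this
    _ = _ := by field_simp

def auxG (η γ δ τ : ℝ) : ℝ :=
  Real.log (η + δ) + Real.log (η + δ + γ) - 2 * Real.log (η + δ + τ)

lemma auxG_abs {η γ δ τ : ℝ} (hη : 0 < η) (hγ : 0 < γ) (hδ : 0 ≤ δ) (h0 : 0 ≤ τ) (h1 : τ ≤ γ) :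
    |auxG η γ δ τ| ≤ Real.log (1 + γ / η) := by
  have e1 : Real.log (η + δ) ≤ Real.log (η + δ + τ) := Real.log_le_log (by linarith) (by linarith)
  have e2 : Real.log (η + δ + τ) ≤ Real.log (η + δ + γ) :=
    Real.log_le_log (by linarith) (by linarith)
  have e3 : Real.log (η + δ + γ) - Real.log (η + δ) ≤ Real.log (1 + γ / η) := by
    rw [← Real.log_div (by linarith) (by linarith)]
    apply Real.log_le_log (by positivity)
    have : (η + δ + γ) / (η + δ) = 1 + γ / (η + δ) := by field_simp
    rw [this]
    gcongr
    linarith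
  unfold auxG
  rw [abs_le]; constructor <;> linarith

lemma auxG_lip1_aux {η γ u v τ : ℝ} (hη : 0 < η) (hγ : 0 < γ) (hu : 0 ≤ u) (hv : u ≤ v)
    (h0 : 0 ≤ τ) (h1 : τ ≤ γ) :
    |auxG η γ (u ^ 2) τ - auxG η γ (v ^ 2) τ| ≤ Real.sqrt γ / η * (v - u) := by
  have huv : u ^ 2 ≤ v ^ 2 := by gcongr
  set A := η + u ^ 2 with hA
  set B := η + v ^ 2 with hB
  have hA0 : 0 < A := by positivity
  have hB0 : 0 < B := by positivity
  have hAB : A ≤ B := by linarith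
  -- monotonicity
  have e1 : Real.log (B + τ) - Real.log B ≤ Real.log (A + τ) - Real.log A := by
    rw [← Real.log_div (by positivity) (by positivity),
      ← Real.log_div (by positivity) (by positivity)]
    apply Real.log_le_log (by positivity)
    rw [div_le_div_iff₀ hB0 hA0]; nlinarith
  have e2 : Real.log (B + γ) - Real.log (B + τ) ≤ Real.log (A + γ) - Real.log (A + τ) := by
    rw [← Real.log_div (by positivity) (by positivity),
      ← Real.log_div (by positivity) (by positivity)]
    apply Real.log_le_log (by positivity)
    rw [div_le_div_iff₀ (by positivity) (by positivity)]; nlinarith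
  have e3 : (Real.log (A + γ) - Real.log A) - (Real.log (B + γ) - Real.log B)
      ≤ Real.sqrt γ / η * (v - u) := by
    have := aux_log_ratio (p := (A + γ) * B) (q := A * (B + γ)) (by positivity) (by positivity)
    rw [Real.log_mul (by positivity) (by positivity),
      Real.log_mul (by positivity) (by positivity)] at this
    have h2 : ((A + γ) * B - A * (B + γ)) / (A * (B + γ)) ≤ Real.sqrt γ / η * (v - u) := by
      rw [div_mul_eq_mul_div, div_le_div_iff₀ (by positivity) hη]
      have hs : Real.sqrt γ ^ 2 = γ := Real.sq_sqrt hγ.le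
      set s := Real.sqrt γ
      have hs0 : 0 ≤ s := Real.sqrt_nonneg γ
      have k1 : s * (u + v) ≤ B + γ := by rw [← hs]; nlinarith [sq_nonneg (s - v)]
      have k2 : ((A + γ) * B - A * (B + γ)) = s * (v - u) * (s * (u + v)) := by
        rw [hA, hB, ← hs]; ring
      rw [k2]
      have k3 : 0 ≤ s * (v - u) := mul_nonneg hs0 (by linarith)
      have k4 : η ≤ A := by rw [hA]; nlinarith [sq_nonneg u]
      calc s * (v - u) * (s * (u + v)) * η ≤ s * (v - u) * (B + γ) * A := by gcongr
        _ = _ := by ring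
    linarith
  unfold auxG
  rw [← hA, ← hB, abs_le]; constructor <;> linarith

lemma auxG_lip1 {η γ u v τ : ℝ} (hη : 0 < η) (hγ : 0 < γ) (hu : 0 ≤ u) (hv : 0 ≤ v)
    (h0 : 0 ≤ τ) (h1 : τ ≤ γ) :
    |auxG η γ (u ^ 2) τ - auxG η γ (v ^ 2) τ| ≤ Real.sqrt γ / η * |u - v| := by
  rcases le_total u v with h | h
  · rw [abs_sub_comm u v, abs_of_nonneg (sub_nonneg.2 h)]
    exact auxG_lip1_aux hη hγ hu h h0 h1
  · rw [abs_sub_comm, abs_of_nonneg (sub_nonneg.2 h)]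
    exact auxG_lip1_aux hη hγ hv h h0 h1

lemma aux_log_lip {c p q : ℝ} (hc : 0 < c) (hp : c ≤ p) (hq : c ≤ q) :
    |Real.log p - Real.log q| ≤ |p - q| / c := by
  have key : ∀ p q : ℝ, c ≤ p → c ≤ q → Real.log p - Real.log q ≤ |p - q| / c := by
    intro p q hp hq
    refine (aux_log_ratio (by linarith) (by linarith)).trans ?_
    calc (p - q) / q ≤ |p - q| / q := by
          have : 0 < q := by linarith
          gcongr; exact le_abs_self _
      _ ≤ _ := by gcongr
  have a1 := key p q hp hq
  have a2 := key q p hq hp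
  rw [abs_sub_comm q p] at a2
  rw [abs_le]; constructor <;> linarith

lemma auxG_lip2 {η γ δ τ σ : ℝ} (hη : 0 < η) (hδ : 0 ≤ δ)
    (h0 : 0 ≤ τ) (h1 : 0 ≤ σ) :
    |auxG η γ δ τ - auxG η γ δ σ| ≤ 2 * (|τ - σ| / η) := by
  have := aux_log_lip (c := η) (p := η + δ + τ) (q := η + δ + σ) hη (by linarith) (by linarith)
  have e : auxG η γ δ τ - auxG η γ δ σ
    = -(2 * (Real.log (η + δ + τ) - Real.log (η + δ + σ))) := by unfold auxG; ring
  rw [e, abs_neg, abs_mul, abs_of_pos (by norm_num : (0:ℝ) < 2)]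
  have e2 : η + δ + τ - (η + δ + σ) = τ - σ := by ring
  rw [e2] at this
  linarith

lemma aux_angle (φ ψ : Real.Angle) :
    ∃ x y : ℝ, φ = (x : Real.Angle) ∧ ψ = (y : Real.Angle) ∧ dist φ ψ = |x - y| := by
  induction ψ using Real.Angle.induction_on with
  | _ y =>
  refine ⟨y + (φ - (y : Real.Angle)).toReal, y, ?_, rfl, ?_⟩
  · rw [Real.Angle.coe_add, Real.Angle.coe_toReal]; abel
  · rw [dist_eq_norm, add_sub_cancel_left]
    conv_lhs => rw [← Real.Angle.coe_toReal (φ - (y : Real.Angle))]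
    refine (AddCircle.norm_coe_eq_abs_iff (p := 2 * π) (by positivity)).2 ?_
    have := Real.Angle.abs_toReal_le_pi (φ - (y : Real.Angle))
    rw [abs_of_pos (by positivity : 0 < 2 * π)]
    linarith

lemma aux_cos_lip (φ ψ : Real.Angle) :
    |Real.Angle.cos φ - Real.Angle.cos ψ| ≤ dist φ ψ := by
  obtain ⟨x, y, rfl, rfl, h⟩ := aux_angle φ ψ
  rw [h, Real.Angle.cos_coe, Real.Angle.cos_coe]
  exact Real.abs_cos_sub_cos_le x y

lemma aux_sqrt1 (φ ψ : Real.Angle) :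
    |Real.sqrt ((1 - Real.Angle.cos φ) / 2) - Real.sqrt ((1 - Real.Angle.cos ψ) / 2)|
      ≤ dist φ ψ / 2 := by
  obtain ⟨x, y, rfl, rfl, h⟩ := aux_angle φ ψ
  rw [h, Real.Angle.cos_coe, Real.Angle.cos_coe, ← Real.abs_sin_half, ← Real.abs_sin_half]
  refine (abs_abs_sub_abs_le _ _).trans ((Real.abs_sin_sub_sin_le _ _).trans (le_of_eq ?_))
  rw [← sub_div, abs_div, abs_of_pos (by norm_num : (0:ℝ) < 2)]

lemma aux_sqrt2 (φ ψ : Real.Angle) :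
    |Real.sqrt ((1 + Real.Angle.cos φ) / 2) - Real.sqrt ((1 + Real.Angle.cos ψ) / 2)|
      ≤ dist φ ψ / 2 := by
  have := aux_sqrt1 (φ + (π : Real.Angle)) (ψ + (π : Real.Angle))
  simpa [Real.Angle.cos_add_pi, sub_neg_eq_add] using this

lemma auxG_log {η γ δ τ F : ℝ} (hη : 0 < η) (hγ : 0 < γ) (hδ : 0 ≤ δ) (h0 : 0 ≤ τ)
    (hF : F = (η + δ) * (η + δ + γ) / (η + δ + τ) ^ 2) :
    0 < F ∧ Real.log F = auxG η γ δ τ := by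
  subst hF
  refine ⟨by positivity, ?_⟩
  rw [Real.log_div (by positivity) (by positivity), Real.log_mul (by positivity) (by positivity),
    Real.log_pow]
  unfold auxG
  push_cast
  ring

lemma auxG_comb {η γ g u v τ σ d e D : ℝ} (hη : 0 < η) (hγ : 0 < γ) (hu : 0 ≤ u) (hv : 0 ≤ v)
    (h0 : 0 ≤ τ) (h1 : τ ≤ γ) (h2 : 0 ≤ σ)
    (huv : |u - v| ≤ Real.sqrt g * (d / 2)) (hts : |τ - σ| ≤ γ * (e / 2))
    (hd : Real.sqrt g * d ≤ D) (he : Real.sqrt γ * e ≤ D) :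
    |auxG η γ (u ^ 2) τ - auxG η γ (v ^ 2) σ| ≤ 3 / 2 * D * (Real.sqrt γ / η) := by
  have a1 := auxG_lip1 hη hγ hu hv h0 h1
  have a2 := auxG_lip2 (γ := γ) hη (sq_nonneg v) h0 h2
  have a3 := abs_sub_le (auxG η γ (u ^ 2) τ) (auxG η γ (v ^ 2) τ) (auxG η γ (v ^ 2) σ)
  have b1 : Real.sqrt γ / η * |u - v| ≤ Real.sqrt γ / η * (D / 2) := by
    gcongr; linarith
  have b2 : 2 * (|τ - σ| / η) ≤ Real.sqrt γ / η * D := by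
    have hs : Real.sqrt γ * Real.sqrt γ = γ := Real.mul_self_sqrt hγ.le
    have : |τ - σ| ≤ Real.sqrt γ * D / 2 := by
      calc |τ - σ| ≤ γ * (e / 2) := hts
        _ = Real.sqrt γ * (Real.sqrt γ * e) / 2 := by
          rw [← mul_assoc, hs]; ring
        _ ≤ _ := by gcongr
    calc 2 * (|τ - σ| / η) ≤ 2 * ((Real.sqrt γ * D / 2) / η) := by gcongr
      _ = _ := by ring
  linarith

def auxF {J : Type*} (Em Ep : J → ℝ) (φ : J → Real.Angle) (j l : J) : ℝ :=
  ((Em l - muD Em Ep φ j) * (Ep l - muD Em Ep φ j) /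
        (muD Em Ep φ l - muD Em Ep φ j) ^ 2)

lemma aux_cos_bd (θ : Real.Angle) : -1 ≤ Real.Angle.cos θ ∧ Real.Angle.cos θ ≤ 1 := by
  induction θ using Real.Angle.induction_on with
  | _ y => exact ⟨Real.neg_one_le_cos y, Real.cos_le_one y⟩

lemma auxF_pair {J : Type*} (Em Ep : J → ℝ) (hlt : ∀ j, Em j < Ep j) (j l : J)
    (hsep : 0 < gapDist Em Ep j l) :
    (∀ φ, 0 < auxF Em Ep φ j l ∧
      |Real.log (auxF Em Ep φ j l)| ≤ Real.log (1 + gapLen Em Ep l / gapDist Em Ep j l)) ∧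
    ∀ φ ψ D, Real.sqrt (gapLen Em Ep j) * dist (φ j) (ψ j) ≤ D →
      Real.sqrt (gapLen Em Ep l) * dist (φ l) (ψ l) ≤ D →
      |Real.log (auxF Em Ep φ j l) - Real.log (auxF Em Ep ψ j l)| ≤
        3 / 2 * D * (Real.sqrt (gapLen Em Ep l) / gapDist Em Ep j l) := by
  have hγl : 0 < gapLen Em Ep l := sub_pos.2 (hlt l)
  have hγj : 0 < gapLen Em Ep j := sub_pos.2 (hlt j)
  have El : Ep l = Em l + gapLen Em Ep l := by unfold gapLen; ring
  have Ej : Ep j = Em j + gapLen Em Ep j := by unfold gapLen; ring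
  rcases le_total (Em j - Ep l) (Em l - Ep j) with h | h
  · have hη : gapDist Em Ep j l = Em l - Ep j := max_eq_left h
    set η := gapDist Em Ep j l with hηdef
    set γ := gapLen Em Ep l with hγ
    set g := gapLen Em Ep j with hg
    have hm : Em l = η + Em j + g := by linarith
    have key : ∀ φ : J → Real.Angle, 0 < auxF Em Ep φ j l ∧ Real.log (auxF Em Ep φ j l) =
        auxG η γ ((Real.sqrt g * Real.sqrt ((1 - Real.Angle.cos (φ j)) / 2)) ^ 2)
          (γ * ((1 + Real.Angle.cos (φ l)) / 2)) := by
      intro φ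
      have c1 := aux_cos_bd (φ j)
      have c2 := aux_cos_bd (φ l)
      refine auxG_log hsep hγl (sq_nonneg _) (mul_nonneg hγl.le (by linarith)) ?_
      rw [mul_pow, Real.sq_sqrt hγj.le, Real.sq_sqrt (by linarith)]
      unfold auxF muD
      rw [← hg, ← hγ, El, hm]
      congr 1
      · ring
      · ring
    refine ⟨fun φ => ⟨(key φ).1, ?_⟩, fun φ ψ D h1 h2 => ?_⟩
    · have c2 := aux_cos_bd (φ l)
      rw [(key φ).2]
      exact auxG_abs hsep hγl (sq_nonneg _) (mul_nonneg hγl.le (by linarith)) (by nlinarith)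
    · have c2 := aux_cos_bd (φ l)
      have c3 := aux_cos_bd (ψ l)
      rw [(key φ).2, (key ψ).2]
      refine auxG_comb (g := g) hsep hγl (by positivity) (by positivity)
        (mul_nonneg hγl.le (by linarith)) (by nlinarith)
        (mul_nonneg hγl.le (by linarith)) ?_ ?_ h1 h2
      · rw [← mul_sub, abs_mul, abs_of_nonneg (Real.sqrt_nonneg g)]
        gcongr
        exact aux_sqrt1 _ _
      · rw [← mul_sub, abs_mul, abs_of_pos hγl]
        gcongr
        have := aux_cos_lip (φ l) (ψ l)
        rw [← sub_div, abs_div, abs_of_pos (by norm_num : (0:ℝ) < 2), add_sub_add_left_eq_sub]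
        linarith
  · have hη : gapDist Em Ep j l = Em j - Ep l := max_eq_right h
    set η := gapDist Em Ep j l with hηdef
    set γ := gapLen Em Ep l with hγ
    set g := gapLen Em Ep j with hg
    have hm : Em j = η + Em l + γ := by linarith
    have key : ∀ φ : J → Real.Angle, 0 < auxF Em Ep φ j l ∧ Real.log (auxF Em Ep φ j l) =
        auxG η γ ((Real.sqrt g * Real.sqrt ((1 + Real.Angle.cos (φ j)) / 2)) ^ 2)
          (γ * ((1 - Real.Angle.cos (φ l)) / 2)) := by
      intro φ
      have c1 := aux_cos_bd (φ j)
      have c2 := aux_cos_bd (φ l)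
      refine auxG_log hsep hγl (sq_nonneg _) (mul_nonneg hγl.le (by linarith)) ?_
      rw [mul_pow, Real.sq_sqrt hγj.le, Real.sq_sqrt (by linarith)]
      unfold auxF muD
      rw [← hg, ← hγ, El, hm]
      congr 1
      · ring
      · ring
    refine ⟨fun φ => ⟨(key φ).1, ?_⟩, fun φ ψ D h1 h2 => ?_⟩
    · have c2 := aux_cos_bd (φ l)
      rw [(key φ).2]
      exact auxG_abs hsep hγl (sq_nonneg _) (mul_nonneg hγl.le (by linarith)) (by nlinarith)
    · have c2 := aux_cos_bd (φ l)
      have c3 := aux_cos_bd (ψ l)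
      rw [(key φ).2, (key ψ).2]
      refine auxG_comb (g := g) hsep hγl (by positivity) (by positivity)
        (mul_nonneg hγl.le (by linarith)) (by nlinarith)
        (mul_nonneg hγl.le (by linarith)) ?_ ?_ h1 h2
      · rw [← mul_sub, abs_mul, abs_of_nonneg (Real.sqrt_nonneg g)]
        gcongr
        exact aux_sqrt2 _ _
      · rw [← mul_sub, abs_mul, abs_of_pos hγl]
        gcongr
        have := aux_cos_lip (φ l) (ψ l)
        rw [← sub_div, abs_div, abs_of_pos (by norm_num : (0:ℝ) < 2), sub_sub_sub_cancel_left,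
          abs_sub_comm]
        linarith

/-- Bounds for `Ψ_j`, for a single fixed index. -/
lemma auxPsi {J : Type*} (Em Ep : J → ℝ) (E0 : ℝ)
    (hlt : ∀ j, Em j < Ep j) (hE0 : ∀ j, E0 < Em j) (j : J)
    (hsep : ∀ l : J, j ≠ l → 0 < gapDist Em Ep j l)
    (hs1 : Summable fun l : {l : J // l ≠ j} => Real.sqrt (gapLen Em Ep l) / gapDist Em Ep j l)
    (hs2 : Summable fun l : {l : J // l ≠ j} => gapLen Em Ep l / gapDist Em Ep j l) :
    (∀ φ, 0 ≤ PsiD Em Ep E0 φ j ∧ PsiD Em Ep E0 φ j ≤ 2 * CraigC Em Ep E0 j) ∧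
    ∀ φ ψ D, (∀ l, Real.sqrt (gapLen Em Ep l) * dist (φ l) (ψ l) ≤ D) →
      |PsiD Em Ep E0 φ j - PsiD Em Ep E0 ψ j| ≤ CraigC Em Ep E0 j *
        (Real.sqrt (gapLen Em Ep j) * D / (Em j - E0) / 2 +
          3 / 2 * D * ∑' l : {l : J // l ≠ j}, Real.sqrt (gapLen Em Ep l) / gapDist Em Ep j l) := by
  have hγ : ∀ l, 0 < gapLen Em Ep l := fun l => sub_pos.2 (hlt l)
  have pair := fun l : {l : J // l ≠ j} => auxF_pair Em Ep hlt j l (hsep l l.2.symm)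
  have hη : ∀ l : {l : J // l ≠ j}, 0 < gapDist Em Ep j l := fun l => hsep l l.2.symm
  have hr : ∀ l : {l : J // l ≠ j}, 0 < gapLen Em Ep l / gapDist Em Ep j l :=
    fun l => div_pos (hγ l) (hη l)
  have hη0 : 0 < Em j - E0 := sub_pos.2 (hE0 j)
  -- summability of logs
  have hsl : Summable fun l : {l : J // l ≠ j} =>
      Real.log (1 + gapLen Em Ep l / gapDist Em Ep j l) := by
    refine Summable.of_nonneg_of_le (fun l => Real.log_nonneg ?_) (fun l => ?_) hs2
    · have := hr l; linarith
    · have h1 := hr l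
      have := Real.log_le_sub_one_of_pos (x := 1 + gapLen Em Ep l / gapDist Em Ep j l)
        (by linarith)
      linarith
  have hsF : ∀ φ, Summable fun l : {l : J // l ≠ j} => Real.log (auxF Em Ep φ j l) := fun φ =>
    Summable.of_norm_bounded hsl (fun l => ((pair l).1 φ).2)
  have hmu : ∀ φ, 0 < muD Em Ep φ j - E0 ∧ Em j ≤ muD Em Ep φ j ∧
      muD Em Ep φ j ≤ Em j + gapLen Em Ep j := by
    intro φ
    have c := aux_cos_bd (φ j)
    have g := hγ j
    have h1 : 0 ≤ gapLen Em Ep j * ((1 + Real.Angle.cos (φ j)) / 2) :=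
      mul_nonneg g.le (by linarith)
    have h2 : gapLen Em Ep j * ((1 + Real.Angle.cos (φ j)) / 2) ≤ gapLen Em Ep j := by nlinarith
    unfold muD
    refine ⟨by linarith, by linarith, by linarith⟩
  set Lg : (J → Real.Angle) → ℝ := fun φ => Real.log (muD Em Ep φ j - E0) +
    ∑' l : {l : J // l ≠ j}, Real.log (auxF Em Ep φ j l) with hLg
  have hPsi : ∀ φ, PsiD Em Ep E0 φ j = 2 * Real.exp (Lg φ / 2) := by
    intro φ
    have : PsiD Em Ep E0 φ j = 2 * Real.sqrt ((muD Em Ep φ j - E0) *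
      ∏' l : {l : J // l ≠ j}, auxF Em Ep φ j l) := rfl
    rw [this, ← Real.rexp_tsum_eq_tprod (fun l => ((pair l).1 φ).1) (hsF φ), Real.exp_half]
    congr 2
    simp only [hLg]
    rw [Real.exp_add, Real.exp_log (hmu φ).1]
  have hC : CraigC Em Ep E0 j = Real.exp ((Real.log (Em j - E0 + gapLen Em Ep j) +
      ∑' l : {l : J // l ≠ j}, Real.log (1 + gapLen Em Ep l / gapDist Em Ep j l)) / 2) := by
    unfold CraigC
    have hlog : ∀ l : {l : J // l ≠ j}, Real.log
        (Real.sqrt (1 + gapLen Em Ep l / gapDist Em Ep j l)) =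
        Real.log (1 + gapLen Em Ep l / gapDist Em Ep j l) / 2 := fun l =>
      Real.log_sqrt (by have := hr l; linarith)
    rw [← Real.rexp_tsum_eq_tprod (fun l => Real.sqrt_pos.2 (by have := hr l; linarith))
      (by simp_rw [hlog]; exact hsl.div_const 2)]
    simp_rw [hlog]
    rw [tsum_div_const, add_div, Real.exp_add]
    congr 1
    rw [Real.exp_half, Real.exp_log (by have := hγ j; linarith)]
  have hle : ∀ φ, Real.exp (Lg φ / 2) ≤ CraigC Em Ep E0 j := by
    intro φ
    rw [hC]
    apply Real.exp_le_exp.2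
    have h1 : Real.log (muD Em Ep φ j - E0) ≤ Real.log (Em j - E0 + gapLen Em Ep j) :=
      Real.log_le_log (hmu φ).1 (by have := (hmu φ).2.2; linarith)
    have h2 := (hsF φ).tsum_le_tsum (fun l => (le_abs_self _).trans ((pair l).1 φ).2) hsl
    simp only [hLg]
    linarith
  refine ⟨fun φ => ⟨by rw [hPsi]; positivity, by rw [hPsi]; linarith [hle φ]⟩, ?_⟩
  intro φ ψ D hD
  have hmain := aux_exp_lip (hle φ) (hle ψ)
  rw [hPsi, hPsi, ← mul_sub, abs_mul, abs_of_pos (by norm_num : (0:ℝ) < 2)]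
  have hC0 : 0 ≤ CraigC Em Ep E0 j := (Real.exp_pos _).le.trans (hle φ)
  have hL : |Lg φ - Lg ψ| ≤ Real.sqrt (gapLen Em Ep j) * D / (Em j - E0) / 2 +
          3 / 2 * D * ∑' l : {l : J // l ≠ j}, Real.sqrt (gapLen Em Ep l) / gapDist Em Ep j l := by
    have e : Lg φ - Lg ψ = (Real.log (muD Em Ep φ j - E0) - Real.log (muD Em Ep ψ j - E0)) +
        ∑' l : {l : J // l ≠ j}, (Real.log (auxF Em Ep φ j l) - Real.log (auxF Em Ep ψ j l)) := by
      rw [(hsF φ).tsum_sub (hsF ψ)]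
      simp only [hLg]; ring
    rw [e]
    refine (abs_add_le _ _).trans (add_le_add ?_ ?_)
    · refine (aux_log_lip hη0 (by linarith [(hmu φ).2.1]) (by linarith [(hmu ψ).2.1])).trans ?_
      have : |muD Em Ep φ j - E0 - (muD Em Ep ψ j - E0)| ≤ Real.sqrt (gapLen Em Ep j) * D / 2 := by
        have e2 : muD Em Ep φ j - E0 - (muD Em Ep ψ j - E0) =
          gapLen Em Ep j * ((Real.Angle.cos (φ j) - Real.Angle.cos (ψ j)) / 2) := by
          unfold muD; ring
        have hs := Real.mul_self_sqrt (hγ j).le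
        rw [e2, abs_mul, abs_of_pos (hγ j), abs_div, abs_of_pos (by norm_num : (0:ℝ) < 2)]
        have h1 := aux_cos_lip (φ j) (ψ j)
        calc _ ≤ gapLen Em Ep j * (dist (φ j) (ψ j) / 2) := by
              have := (hγ j).le
              gcongr
          _ = Real.sqrt (gapLen Em Ep j) *
              (Real.sqrt (gapLen Em Ep j) * dist (φ j) (ψ j)) / 2 := by
              rw [← mul_assoc, hs]; ring
          _ ≤ _ := by gcongr; exact hD j
      calc _ ≤ (Real.sqrt (gapLen Em Ep j) * D / 2) / (Em j - E0) := by gcongr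
        _ = _ := by ring
    · rw [← tsum_mul_left]
      have hb : ∀ l : {l : J // l ≠ j},
        ‖Real.log (auxF Em Ep φ j l) - Real.log (auxF Em Ep ψ j l)‖ ≤
        3 / 2 * D * (Real.sqrt (gapLen Em Ep l) / gapDist Em Ep j l) := fun l =>
          (pair l).2 φ ψ D (hD j) (hD l)
      exact tsum_of_norm_bounded (hs1.mul_left _).hasSum hb
  have e3 : |Lg φ / 2 - Lg ψ / 2| = |Lg φ - Lg ψ| / 2 := by
    rw [← sub_div, abs_div, abs_of_pos (by norm_num : (0:ℝ) < 2)]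
  rw [e3] at hmain
  calc _ ≤ 2 * (CraigC Em Ep E0 j * (|Lg φ - Lg ψ| / 2)) := by gcongr
    _ = CraigC Em Ep E0 j * |Lg φ - Lg ψ| := by ring
    _ ≤ _ := by gcongr

lemma aux_one_le_tprod {ι : Type*} (f : ι → ℝ) (h : ∀ i, 1 ≤ f i) : 1 ≤ ∏' i, f i := by
  by_cases hm : Multipliable f
  · refine ge_of_tendsto hm.hasProd (Filter.Eventually.of_forall fun s => ?_)
    induction s using Finset.cons_induction with
    | empty => simp
    | cons a s ha ih => rw [Finset.prod_cons]; nlinarith [h a]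
  · rw [tprod_eq_one_of_not_multipliable hm]

lemma aux_dist_le (φ ψ : Real.Angle) : dist φ ψ ≤ π := by
  rw [dist_eq_norm]
  have := AddCircle.norm_le_half_period (p := 2 * π) (x := φ - ψ) (by positivity)
  rw [abs_of_pos (by positivity : 0 < 2 * π)] at this
  calc _ ≤ _ := this
    _ = π := by ring

/-- Under the Craig conditions (C2), the KdV vector field `Ξ` is Lipschitz on `D(S)`
with respect to the metric `‖φ - φ̃‖ = sup_j γ_j^{1/2} d_𝕋(φ_j, φ̃_j)`. -/
theorem xi_lipschitz
    {J : Type*} [Countable J] (Em Ep : J → ℝ) (E0 : ℝ)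
    (hlt : ∀ j, Em j < Ep j) (hE0 : ∀ j, E0 < Em j)
    (hsep : ∀ j l : J, j ≠ l → 0 < gapDist Em Ep j l)
    -- Craig conditions (C2):
    (hC2a : Summable fun j => Real.sqrt (gapLen Em Ep j))
    (hC2b : ∃ M : ℝ, ∀ j,
      Real.sqrt (gapLen Em Ep j) * ((1 + (Em j - E0)) / (Em j - E0)) * CraigC Em Ep E0 j ≤ M)
    (hC2c : ∀ a : ℝ, a = 1/2 ∨ a = 1 →
      (∀ j, Summable fun l : {l : J // l ≠ j} =>
        (Real.sqrt (gapLen Em Ep j) * Real.sqrt (gapLen Em Ep l) / gapDist Em Ep j l) ^ a *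
          (1 + (Em j - E0)) * CraigC Em Ep E0 j) ∧
      (∃ M : ℝ, ∀ j,
        (∑' l : {l : J // l ≠ j},
          (Real.sqrt (gapLen Em Ep j) * Real.sqrt (gapLen Em Ep l) / gapDist Em Ep j l) ^ a *
            (1 + (Em j - E0)) * CraigC Em Ep E0 j) ≤ M)) :
    ∃ K : ℝ, ∀ φ ψ : J → Real.Angle,
      (⨆ j, Real.sqrt (gapLen Em Ep j) * |XiD Em Ep E0 φ j - XiD Em Ep E0 ψ j|) ≤
        K * ⨆ j, Real.sqrt (gapLen Em Ep j) * dist (φ j) (ψ j) := by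

  have hγ : ∀ l, 0 < gapLen Em Ep l := fun l => sub_pos.2 (hlt l)
  have hη0 : ∀ j, 0 < Em j - E0 := fun j => sub_pos.2 (hE0 j)
  obtain ⟨M, hM⟩ := hC2b
  obtain ⟨hsum, M1, hM1⟩ := hC2c 1 (Or.inr rfl)
  simp only [Real.rpow_one] at hsum hM1
  set S := ∑' j, Real.sqrt (gapLen Em Ep j) with hS
  have hsS : ∀ j, Real.sqrt (gapLen Em Ep j) ≤ S := fun j =>
    hC2a.le_tsum j (fun l _ => Real.sqrt_nonneg _)
  have hS0 : 0 ≤ S := tsum_nonneg fun l => Real.sqrt_nonneg _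
  have hγS : ∀ j, gapLen Em Ep j ≤ S * Real.sqrt (gapLen Em Ep j) := fun j => by
    have h1 := Real.mul_self_sqrt (hγ j).le
    have h2 := hsS j
    have h3 := Real.sqrt_nonneg (gapLen Em Ep j)
    nlinarith
  have hγsum : Summable fun j => gapLen Em Ep j :=
    Summable.of_nonneg_of_le (fun j => (hγ j).le) hγS (hC2a.mul_left S)
  set G := ∑' j, gapLen Em Ep j with hG
  have hγG : ∀ j, gapLen Em Ep j ≤ G := fun j => hγsum.le_tsum j (fun l _ => (hγ l).le)
  have hG0 : 0 ≤ G := tsum_nonneg fun l => (hγ l).le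
  have hCpos : ∀ j, 0 < CraigC Em Ep E0 j := by
    intro j
    refine mul_pos (Real.sqrt_pos.2 (by have := hγ j; have := hη0 j; linarith)) ?_
    refine lt_of_lt_of_le one_pos (aux_one_le_tprod _ fun l => ?_)
    rw [Real.one_le_sqrt]
    have := div_pos (hγ l) (hsep j l l.2.symm)
    linarith
  have hs1 : ∀ j, Summable fun l : {l : J // l ≠ j} =>
      Real.sqrt (gapLen Em Ep l) / gapDist Em Ep j l := by
    intro j
    have hne : Real.sqrt (gapLen Em Ep j) * ((1 + (Em j - E0)) * CraigC Em Ep E0 j) ≠ 0 := by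
      have h1 := Real.sqrt_pos.2 (hγ j)
      have h2 := hη0 j
      have h3 := hCpos j
      positivity
    rw [← summable_mul_left_iff hne]
    refine (hsum j).congr fun l => ?_
    ring
  have hs2 : ∀ j, Summable fun l : {l : J // l ≠ j} =>
      gapLen Em Ep l / gapDist Em Ep j l := by
    intro j
    refine Summable.of_nonneg_of_le (fun l => (div_pos (hγ l) (hsep j l l.2.symm)).le)
      (fun l => ?_) ((hs1 j).mul_left S)
    have := hsep j l l.2.symm
    rw [← mul_div_assoc]
    gcongr
    exact hγS l
  have hM1' : ∀ j, Real.sqrt (gapLen Em Ep j) * (1 + (Em j - E0)) * CraigC Em Ep E0 j *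
      ∑' l : {l : J // l ≠ j}, Real.sqrt (gapLen Em Ep l) / gapDist Em Ep j l ≤ |M1| := by
    intro j
    refine le_trans (le_of_eq ?_) ((hM1 j).trans (le_abs_self _))
    rw [← tsum_mul_left]
    exact tsum_congr fun l => by ring
  have hMb : ∀ j, Real.sqrt (gapLen Em Ep j) * CraigC Em Ep E0 j *
      ((1 + (Em j - E0)) / (Em j - E0)) ≤ |M| := fun j =>
    le_trans (le_of_eq (by ring)) ((hM j).trans (le_abs_self _))
  have hMc : ∀ j, Real.sqrt (gapLen Em Ep j) * CraigC Em Ep E0 j ≤ |M| := by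
    intro j
    refine le_trans ?_ (hMb j)
    have h1 := (hCpos j).le
    have h2 := hη0 j
    refine le_mul_of_one_le_right (by positivity) ?_
    rw [le_div_iff₀ h2]; linarith
  set B := 3 * |E0| + 3 * G + 2 with hB
  have hB0 : 0 ≤ B := by positivity
  refine ⟨2 * (4 * S * |M| + B * (S / 2 * |M| + 3 / 2 * |M1|)), fun φ ψ => ?_⟩
  set D := ⨆ j, Real.sqrt (gapLen Em Ep j) * dist (φ j) (ψ j) with hDdef
  have hD : ∀ l, Real.sqrt (gapLen Em Ep l) * dist (φ l) (ψ l) ≤ D := by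
    intro l
    refine le_ciSup (f := fun l => Real.sqrt (gapLen Em Ep l) * dist (φ l) (ψ l)) ⟨S * π, ?_⟩ l
    rintro _ ⟨k, rfl⟩
    exact mul_le_mul (hsS k) (aux_dist_le _ _) dist_nonneg hS0
  have hD0 : 0 ≤ D := Real.iSup_nonneg fun l => mul_nonneg (Real.sqrt_nonneg _) dist_nonneg
  refine Real.iSup_le (fun j => ?_) (by positivity)
  -- `μ` estimates
  have hmu : ∀ l, |2 * muD Em Ep φ l - 2 * muD Em Ep ψ l| ≤ Real.sqrt (gapLen Em Ep l) * D := by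
    intro l
    have e2 : 2 * muD Em Ep φ l - 2 * muD Em Ep ψ l =
      gapLen Em Ep l * (Real.Angle.cos (φ l) - Real.Angle.cos (ψ l)) := by
      unfold muD; ring
    rw [e2, abs_mul, abs_of_pos (hγ l)]
    have h1 := aux_cos_lip (φ l) (ψ l)
    have hs := Real.mul_self_sqrt (hγ l).le
    calc _ ≤ gapLen Em Ep l * dist (φ l) (ψ l) := by
          have := (hγ l).le
          gcongr
      _ = Real.sqrt (gapLen Em Ep l) *
          (Real.sqrt (gapLen Em Ep l) * dist (φ l) (ψ l)) := by
          rw [← mul_assoc, hs]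
      _ ≤ _ := by gcongr; exact hD l
  have hqb : ∀ (χ : J → Real.Angle) l, ‖Em l + Ep l - 2 * muD Em Ep χ l‖ ≤ gapLen Em Ep l := by
    intro χ l
    have e : Em l + Ep l - 2 * muD Em Ep χ l = -(gapLen Em Ep l * Real.Angle.cos (χ l)) := by
      unfold muD gapLen; ring
    rw [e, norm_neg, Real.norm_eq_abs, abs_mul, abs_of_pos (hγ l)]
    have : |Real.Angle.cos (χ l)| ≤ 1 := abs_le.2 (aux_cos_bd _)
    have := (hγ l).le
    exact mul_le_of_le_one_right this ‹_›
  have hqs : ∀ χ : J → Real.Angle, Summable fun l => Em l + Ep l - 2 * muD Em Ep χ l :=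
    fun χ => Summable.of_norm_bounded hγsum (hqb χ)
  have hdQ : |Q1D Em Ep E0 φ - Q1D Em Ep E0 ψ| ≤ S * D := by
    have e : Q1D Em Ep E0 φ - Q1D Em Ep E0 ψ =
        ∑' l, ((Em l + Ep l - 2 * muD Em Ep φ l) - (Em l + Ep l - 2 * muD Em Ep ψ l)) := by
      rw [(hqs φ).tsum_sub (hqs ψ)]
      unfold Q1D; ring
    rw [e]
    rw [← Real.norm_eq_abs]
    refine tsum_of_norm_bounded (hC2a.hasSum.mul_right D) fun l => ?_
    rw [sub_sub_sub_cancel_left, norm_sub_rev]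
    exact hmu l
  have hA : |Q1D Em Ep E0 ψ + 2 * muD Em Ep ψ j| ≤ B * (1 + (Em j - E0)) := by
    have h1 : |∑' l, (Em l + Ep l - 2 * muD Em Ep ψ l)| ≤ G :=
      tsum_of_norm_bounded hγsum.hasSum (hqb ψ)
    have c := aux_cos_bd (ψ j)
    have g := hγ j
    have gG := hγG j
    have h2 : 0 ≤ gapLen Em Ep j * ((1 + Real.Angle.cos (ψ j)) / 2) :=
      mul_nonneg g.le (by linarith)
    have h3 : gapLen Em Ep j * ((1 + Real.Angle.cos (ψ j)) / 2) ≤ gapLen Em Ep j := by nlinarith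
    have h4 : 3 * |E0| + 3 * G + 2 * (Em j - E0) ≤ B * (1 + (Em j - E0)) := by
      have := hη0 j
      have := abs_nonneg E0
      rw [hB]; nlinarith [mul_nonneg this (hη0 j).le, mul_nonneg hG0 (hη0 j).le]
    refine le_trans ?_ h4
    have h5 := hη0 j
    obtain ⟨h6, h7⟩ := abs_le.1 h1
    have h8 := neg_abs_le E0
    have h9 := le_abs_self E0
    unfold Q1D
    unfold muD at h6 h7 ⊢
    rw [abs_le]
    constructor <;> linarith
  obtain ⟨hp1, hp2⟩ := auxPsi Em Ep E0 hlt hE0 j (hsep j) (hs1 j) (hs2 j)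
  obtain ⟨hP0, hPC⟩ := hp1 φ
  have hdP := hp2 φ ψ D hD
  have hdA : |(Q1D Em Ep E0 φ + 2 * muD Em Ep φ j) - (Q1D Em Ep E0 ψ + 2 * muD Em Ep ψ j)|
      ≤ 2 * S * D := by
    have h1 := hmu j
    have h2 : Real.sqrt (gapLen Em Ep j) * D ≤ S * D := by gcongr; exact hsS j
    have e : (Q1D Em Ep E0 φ + 2 * muD Em Ep φ j) - (Q1D Em Ep E0 ψ + 2 * muD Em Ep ψ j) =
      (Q1D Em Ep E0 φ - Q1D Em Ep E0 ψ) + (2 * muD Em Ep φ j - 2 * muD Em Ep ψ j) := by ring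
    rw [e]
    refine (abs_add_le _ _).trans ?_
    linarith
  have hMb := hMb j
  have hMc := hMc j
  have hM1' := hM1' j
  have hsj := hsS j
  have hC := hCpos j
  have hη := hη0 j
  have hT0 : 0 ≤ ∑' l : {l : J // l ≠ j}, Real.sqrt (gapLen Em Ep l) / gapDist Em Ep j l :=
    tsum_nonneg fun l => div_nonneg (Real.sqrt_nonneg _) (hsep j l l.2.symm).le
  have eX : XiD Em Ep E0 φ j - XiD Em Ep E0 ψ j =
      -2 * (((Q1D Em Ep E0 φ + 2 * muD Em Ep φ j) - (Q1D Em Ep E0 ψ + 2 * muD Em Ep ψ j)) *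
        PsiD Em Ep E0 φ j + (Q1D Em Ep E0 ψ + 2 * muD Em Ep ψ j) *
        (PsiD Em Ep E0 φ j - PsiD Em Ep E0 ψ j)) := by
    unfold XiD; ring
  rw [eX, abs_mul, abs_neg, abs_of_pos (by norm_num : (0:ℝ) < 2)]
  clear_value D B S G
  generalize (∑' l : {l : J // l ≠ j}, Real.sqrt (gapLen Em Ep l) / gapDist Em Ep j l) = T at *
  have hs0 := Real.sqrt_nonneg (gapLen Em Ep j)
  generalize Real.sqrt (gapLen Em Ep j) = s at *
  generalize (Q1D Em Ep E0 φ + 2 * muD Em Ep φ j) = A at *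
  generalize (Q1D Em Ep E0 ψ + 2 * muD Em Ep ψ j) = A' at *
  generalize PsiD Em Ep E0 φ j = P at *
  generalize PsiD Em Ep E0 ψ j = P' at *
  generalize CraigC Em Ep E0 j = C at *
  generalize Em j - E0 = h at *
  have k1 : |(A - A') * P + A' * (P - P')| ≤ 2 * S * D * (2 * C) +
      B * (1 + h) * (C * (s * D / h / 2 + 3 / 2 * D * T)) := by
    refine (abs_add_le _ _).trans ?_
    rw [abs_mul, abs_mul, abs_of_nonneg hP0]
    gcongr
  calc s * (2 * |(A - A') * P + A' * (P - P')|)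
      ≤ s * (2 * (2 * S * D * (2 * C) +
      B * (1 + h) * (C * (s * D / h / 2 + 3 / 2 * D * T)))) := by gcongr
    _ = 2 * (4 * S * (s * C) + B * (s / 2 * (s * C * ((1 + h) / h)) +
        3 / 2 * (s * (1 + h) * C * T))) * D := by field_simp; ring
    _ ≤ _ := by gcongr
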